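/- arXiv:1510.02714 — 14 statements merged into one kernel-verified Lean document; each statement's English description precedes it below -/
import Mathlib

section
/- Let k be a field, A a k-algebra, B a finite-dimensional k-algebra, and f : A → B a homomorphism of k-algebras. Then f is surjective if and only if both of the following hold: (i) for every finite-dimensional B-module X and every A-submodule Y of X (where X is viewed as an A-module via restriction of scalars along f), Y is B-stable, i.e. b·Y ⊆ Y for all b ∈ B; and (ii) every A-linear map between finite-dimensional B-modules (viewed as A-modules via f) is B-linear. -/
/-- **Injectivity lemma, algebra side (over a field).**
Let `k` be a field, `A` a `k`-algebra, `B` a finite-dimensional `k`-algebra and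
`f : A → B` a `k`-algebra homomorphism.  Then `f` is surjective iff
(i) for every finite-dimensional `B`-module `X` and every `A`-submodule `Y` of `X`
(where `X` is an `A`-module via restriction of scalars along `f`, so an `A`-submodule
is a `k`-subspace stable under `f a • ·` for all `a : A`), `Y` is `B`-stable, and
(ii) every `A`-linear map between finite-dimensional `B`-modules is `B`-linear. -/
theorem statement0 (k A B : Type) [Field k] [Ring A] [Ring B] [Algebra k A] [Algebra k B]
    [FiniteDimensional k B] (f : A →ₐ[k] B) :
    Function.Surjective f ↔
      ((∀ (X : Type) [AddCommGroup X] [Module k X] [Module B X] [IsScalarTower k B X]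
          [FiniteDimensional k X],
          ∀ Y : Submodule k X, (∀ a : A, ∀ y ∈ Y, f a • y ∈ Y) →
            ∀ b : B, ∀ y ∈ Y, b • y ∈ Y) ∧
        (∀ (X X' : Type) [AddCommGroup X] [Module k X] [Module B X] [IsScalarTower k B X]
          [FiniteDimensional k X]
          [AddCommGroup X'] [Module k X'] [Module B X'] [IsScalarTower k B X']
          [FiniteDimensional k X'],
          ∀ φ : X →ₗ[k] X', (∀ (a : A) (x : X), φ (f a • x) = f a • φ x) →
            ∀ (b : B) (x : X), φ (b • x) = b • φ x)) := by
  constructor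
  · intro hf
    refine ⟨?_, ?_⟩
    · intro X _ _ _ _ _ Y hY b y hy
      obtain ⟨a, rfl⟩ := hf b
      exact hY a y hy
    · intro X X' _ _ _ _ _ _ _ _ _ _ φ hφ b x
      obtain ⟨a, rfl⟩ := hf b
      exact hφ a x
  · rintro ⟨hstable, -⟩ b
    have hb := hstable B (LinearMap.range f.toLinearMap)
      (by
        rintro a _ ⟨c, rfl⟩
        exact ⟨a * c, map_mul f a c⟩)
      b 1 ⟨1, map_one f⟩
    rw [smul_eq_mul, mul_one] at hb
    exact hb
end

section
/- Let k be a field and f : C → D a homomorphism of finite-dimensional k-coalgebras. Then f is injective if and only if for every finite-dimensional right C-comodule (M, ρ) and every k-subspace N ⊆ M which is a D-subcomodule via f (i.e. (id_M ⊗ f)∘ρ maps N into the image of N ⊗ D in M ⊗ D), the subspace N is C-stable (i.e. ρ(N) is contained in the image of N ⊗ C in M ⊗ C), and moreover every k-linear map between finite-dimensional C-comodules which is a map of D-comodules (via f) is a map of C-comodules. -/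
open TensorProduct LinearMap

section Slice

variable {k : Type*} [CommSemiring k] {M C : Type*} [AddCommMonoid M] [Module k M]
  [AddCommMonoid C] [Module k C]

/-- Contraction of the right tensor factor with a linear functional. -/
noncomputable def sliceRight (ψ : C →ₗ[k] k) : M ⊗[k] C →ₗ[k] M :=
  (TensorProduct.rid k M).toLinearMap ∘ₗ lTensor M ψ

@[simp]
theorem sliceRight_tmul (ψ : C →ₗ[k] k) (m : M) (c : C) :
    sliceRight ψ (m ⊗ₜ[k] c) = ψ c • m := by
  simp [sliceRight]

theorem sliceRight_comp_apply {D : Type*} [AddCommMonoid D] [Module k D] (φ : D →ₗ[k] k)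
    (f : C →ₗ[k] D) (t : M ⊗[k] C) :
    sliceRight (φ ∘ₗ f) t = sliceRight φ (lTensor M f t) := by
  simp [sliceRight, lTensor_comp]

/-- The submodule of all contractions of a tensor. -/
noncomputable def sliceSpan (t : M ⊗[k] C) : Submodule k M :=
  LinearMap.range ((TensorProduct.rid k M).toLinearMap ∘ₗ
    LinearMap.applyₗ t ∘ₗ LinearMap.lTensorHom (R := k) (N := C) (P := k) M)

theorem mem_sliceSpan {t : M ⊗[k] C} {m : M} :
    m ∈ sliceSpan t ↔ ∃ φ : C →ₗ[k] k, sliceRight φ t = m :=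
  Iff.rfl

theorem sliceRight_mem_of_mem_range {N : Submodule k M} {t : M ⊗[k] C}
    (ht : t ∈ LinearMap.range (TensorProduct.map N.subtype (LinearMap.id : C →ₗ[k] C)))
    (ψ : C →ₗ[k] k) : sliceRight ψ t ∈ N := by
  obtain ⟨y, rfl⟩ := ht
  induction y with
  | zero => simp
  | tmul n c => simpa using N.smul_mem _ n.2
  | add x y hx hy => simpa using N.add_mem hx hy

theorem mem_range_of_forall_sliceRight_mem [Module.Free k C] [Module.Finite k C]
    {N : Submodule k M} {t : M ⊗[k] C} (ht : ∀ ψ : C →ₗ[k] k, sliceRight ψ t ∈ N) :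
    t ∈ LinearMap.range (TensorProduct.map N.subtype (LinearMap.id : C →ₗ[k] C)) := by
  classical
  let b := Module.Free.chooseBasis k C
  have expand : t = ∑ i, sliceRight (b.coord i) t ⊗ₜ[k] b i := by
    clear ht
    induction t with
    | zero => simp
    | tmul m c =>
      conv_lhs => rw [← b.sum_repr c, TensorProduct.tmul_sum]
      simp [TensorProduct.smul_tmul]
    | add x y hx hy =>
      simp only [map_add, TensorProduct.add_tmul, Finset.sum_add_distrib]
      rw [← hx, ← hy]
  rw [expand]
  exact Submodule.sum_mem _ fun i _ => ⟨⟨_, ht (b.coord i)⟩ ⊗ₜ[k] b i, by simp⟩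

end Slice

section Comodule

variable {k : Type*} [CommSemiring k] {M C D : Type*} [AddCommMonoid M] [Module k M]
  [AddCommMonoid C] [Module k C] [Coalgebra k C]
  [AddCommMonoid D] [Module k D] [Coalgebra k D]

/-- The product of two functionals on a coalgebra dual to the comultiplication. -/
noncomputable def functionalMul (ψ φ : C →ₗ[k] k) : C →ₗ[k] k :=
  LinearMap.mul' k k ∘ₗ TensorProduct.map ψ φ ∘ₗ Coalgebra.comul

theorem functionalMul_comp (f : C →ₗc[k] D) (ψ φ : D →ₗ[k] k) :
    functionalMul (ψ ∘ₗ f.toLinearMap) (φ ∘ₗ f.toLinearMap) =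
      functionalMul ψ φ ∘ₗ f.toLinearMap := by
  simp only [functionalMul, TensorProduct.map_comp, LinearMap.comp_assoc, f.map_comp_comul]

theorem sliceRight_coaction_sliceRight (ρ : M →ₗ[k] M ⊗[k] C)
    (hρ : ∀ m : M, (TensorProduct.assoc k M C C) ((rTensor C ρ) (ρ m)) =
      (lTensor M (Coalgebra.comul : C →ₗ[k] C ⊗[k] C)) (ρ m))
    (ψ φ : C →ₗ[k] k) (m : M) :
    sliceRight ψ (ρ (sliceRight φ (ρ m))) = sliceRight (functionalMul ψ φ) (ρ m) := by
  have key (t : M ⊗[k] C) : sliceRight ψ (ρ (sliceRight φ t)) =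
      sliceRight (LinearMap.mul' k k ∘ₗ TensorProduct.map ψ φ)
        (TensorProduct.assoc k M C C (rTensor C ρ t)) := by
    induction t with
    | zero => simp
    | add x y hx hy => simp only [map_add, hx, hy]
    | tmul n c =>
      simp only [sliceRight_tmul, map_smul, rTensor_tmul]
      generalize ρ n = s
      induction s with
      | zero => simp
      | add x y hx hy => simp only [map_add, smul_add, TensorProduct.add_tmul, hx, hy]
      | tmul n' c' => simp [smul_smul, mul_comm]
  rw [key, hρ, ← sliceRight_comp_apply, LinearMap.comp_assoc]
  rfl

theorem lTensor_coaction_mem_range_sliceSpan [Module.Free k D] [Module.Finite k D]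
    (f : C →ₗc[k] D) (ρ : M →ₗ[k] M ⊗[k] C)
    (hρ : ∀ m : M, (TensorProduct.assoc k M C C) ((rTensor C ρ) (ρ m)) =
      (lTensor M (Coalgebra.comul : C →ₗ[k] C ⊗[k] C)) (ρ m))
    (m n : M) (hn : n ∈ sliceSpan (lTensor M f.toLinearMap (ρ m))) :
    lTensor M f.toLinearMap (ρ n) ∈ LinearMap.range (TensorProduct.map
      (sliceSpan (lTensor M f.toLinearMap (ρ m))).subtype (LinearMap.id : D →ₗ[k] D)) := by
  obtain ⟨φ, rfl⟩ := mem_sliceSpan.1 hn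
  refine mem_range_of_forall_sliceRight_mem fun ψ => mem_sliceSpan.2
    ⟨functionalMul ψ φ, ?_⟩
  rw [← sliceRight_comp_apply, ← sliceRight_comp_apply, ← sliceRight_comp_apply,
    sliceRight_coaction_sliceRight ρ hρ, functionalMul_comp]

theorem mem_sliceSpan_coaction (f : C →ₗc[k] D) (ρ : M →ₗ[k] M ⊗[k] C)
    (hε : ∀ m : M, (TensorProduct.rid k M)
      ((lTensor M (Coalgebra.counit : C →ₗ[k] k)) (ρ m)) = m) (m : M) :
    m ∈ sliceSpan (lTensor M f.toLinearMap (ρ m)) := by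
  refine mem_sliceSpan.2 ⟨Coalgebra.counit, ?_⟩
  rw [← sliceRight_comp_apply, f.counit_comp]
  exact hε m

/-- The coaction of the cofree comodule on `V`. -/
noncomputable def cofreeCoaction (V C : Type*) [AddCommMonoid V] [Module k V]
    [AddCommMonoid C] [Module k C] [Coalgebra k C] :
    V ⊗[k] C →ₗ[k] (V ⊗[k] C) ⊗[k] C :=
  (TensorProduct.assoc k V C C).symm.toLinearMap ∘ₗ lTensor V Coalgebra.comul

theorem cofreeCoaction_tmul (v : M) (c : C) : cofreeCoaction (k := k) M C (v ⊗ₜ[k] c) =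
    (TensorProduct.assoc k M C C).symm (v ⊗ₜ[k] Coalgebra.comul c) := by
  simp [cofreeCoaction]

theorem cofreeCoaction_coassoc (t : M ⊗[k] C) :
    TensorProduct.assoc k (M ⊗[k] C) C C
        (rTensor C (cofreeCoaction (k := k) M C) (cofreeCoaction (k := k) M C t)) =
      lTensor (M ⊗[k] C) Coalgebra.comul (cofreeCoaction (k := k) M C t) := by
  induction t with
  | zero => simp
  | add x y hx hy => simp only [map_add, hx, hy]
  | tmul v c =>
    have left (s : C ⊗[k] C) : TensorProduct.assoc k (M ⊗[k] C) C C
        (rTensor C (cofreeCoaction (k := k) M C) ((TensorProduct.assoc k M C C).symm (v ⊗ₜ s))) =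
        (TensorProduct.assoc k M C (C ⊗[k] C)).symm
          (v ⊗ₜ TensorProduct.assoc k C C C (rTensor C Coalgebra.comul s)) := by
      induction s with
      | zero => simp
      | add x y hx hy => simp only [map_add, TensorProduct.tmul_add, hx, hy]
      | tmul a b =>
        simp only [TensorProduct.assoc_symm_tmul, rTensor_tmul, cofreeCoaction_tmul]
        generalize Coalgebra.comul (R := k) a = u
        induction u with
        | zero => simp
        | add x y hx hy => simp only [map_add, TensorProduct.tmul_add, TensorProduct.add_tmul, hx, hy]
        | tmul p q => simp
    have right (s : C ⊗[k] C) :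
        lTensor (M ⊗[k] C) Coalgebra.comul ((TensorProduct.assoc k M C C).symm (v ⊗ₜ s)) =
        (TensorProduct.assoc k M C (C ⊗[k] C)).symm
          (v ⊗ₜ lTensor C Coalgebra.comul s) := by
      induction s with
      | zero => simp
      | add x y hx hy => simp only [map_add, TensorProduct.tmul_add, hx, hy]
      | tmul a b => simp
    rw [cofreeCoaction_tmul, left, right, Coalgebra.coassoc_apply]

theorem sliceRight_cofreeCoaction (ψ : C →ₗ[k] k) (t : M ⊗[k] C) :
    sliceRight ψ (cofreeCoaction (k := k) M C t) =
      lTensor M (sliceRight ψ ∘ₗ Coalgebra.comul) t := by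
  induction t with
  | zero => simp
  | add x y hx hy => simp only [map_add, hx, hy]
  | tmul v c =>
    simp only [cofreeCoaction_tmul, lTensor_tmul, LinearMap.comp_apply]
    generalize Coalgebra.comul (R := k) c = s
    induction s with
    | zero => simp
    | add x y hx hy => simp only [map_add, TensorProduct.tmul_add, hx, hy]
    | tmul a b => simp

theorem sliceRight_counit_comp_comul :
    sliceRight (Coalgebra.counit (R := k) (A := C)) ∘ₗ Coalgebra.comul = LinearMap.id := by
  ext c
  simp [sliceRight]

theorem cofreeCoaction_counit (t : M ⊗[k] C) :
    TensorProduct.rid k (M ⊗[k] C)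
      (lTensor (M ⊗[k] C) Coalgebra.counit (cofreeCoaction (k := k) M C t)) = t := by
  have h := sliceRight_cofreeCoaction (Coalgebra.counit (R := k) (A := C)) t
  rw [sliceRight_counit_comp_comul, lTensor_id] at h
  exact h

theorem counit_sliceRight_comul (ψ : C →ₗ[k] k) (c : C) :
    Coalgebra.counit (R := k) (sliceRight ψ (Coalgebra.comul (R := k) c)) = ψ c := by
  have key (s : C ⊗[k] C) : Coalgebra.counit (R := k) (sliceRight ψ s) =
      ψ (TensorProduct.lid k C (rTensor C Coalgebra.counit s)) := by
    induction s with
    | zero => simp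
    | add x y hx hy => simp only [map_add, hx, hy]
    | tmul a b => simp [mul_comm]
  rw [key]
  simp

theorem dualTensorHom_lTensor {V W W' : Type*} [AddCommMonoid V] [Module k V]
    [AddCommMonoid W] [Module k W] [AddCommMonoid W'] [Module k W'] (g : W →ₗ[k] W')
    (t : Module.Dual k V ⊗[k] W) :
    dualTensorHom k V W' (lTensor _ g t) = g ∘ₗ dualTensorHom k V W t := by
  induction t with
  | zero => simp
  | add x y hx hy => simp only [map_add, hx, hy, LinearMap.comp_add]
  | tmul v w => ext; simp

theorem eq_of_sliceRight_cofreeCoaction_eq {t : Module.Dual k C ⊗[k] C}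
    (ht : dualTensorHom k C C t = LinearMap.id) {ψ φ : C →ₗ[k] k}
    (h : sliceRight ψ (cofreeCoaction (k := k) (Module.Dual k C) C t) =
      sliceRight φ (cofreeCoaction (k := k) (Module.Dual k C) C t)) : ψ = φ := by
  rw [sliceRight_cofreeCoaction, sliceRight_cofreeCoaction] at h
  have h' := congrArg (dualTensorHom k C C) h
  rw [dualTensorHom_lTensor, dualTensorHom_lTensor, ht] at h'
  ext c
  simpa [counit_sliceRight_comul] using
    congrArg (Coalgebra.counit (R := k)) (LinearMap.congr_fun h' c)

end Comodule

/-- **Injectivity lemma for finite-dimensional coalgebras over a field.**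
A homomorphism `f : C → D` of finite-dimensional `k`-coalgebras is injective iff
(i) for every finite-dimensional right `C`-comodule `(M, ρ)` and every subspace
`N ⊆ M` which is a `D`-subcomodule via `f` (i.e. `(id_M ⊗ f) ∘ ρ` maps `N` into the
image of `N ⊗ D` in `M ⊗ D`), the subspace `N` is `C`-stable (i.e. `ρ(N)` lies in the
image of `N ⊗ C` in `M ⊗ C`), and (ii) every `k`-linear map of finite-dimensional
`C`-comodules which is a map of `D`-comodules via `f` is a map of `C`-comodules. -/
theorem statement2 (k C D : Type) [Field k]
    [AddCommGroup C] [Module k C] [Coalgebra k C] [FiniteDimensional k C]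
    [AddCommGroup D] [Module k D] [Coalgebra k D] [FiniteDimensional k D]
    (f : C →ₗc[k] D) :
    Function.Injective f ↔
      ((∀ (M : Type) [AddCommGroup M] [Module k M] [FiniteDimensional k M],
          ∀ ρ : M →ₗ[k] M ⊗[k] C,
            (∀ m : M, (TensorProduct.assoc k M C C) ((rTensor C ρ) (ρ m)) =
                (lTensor M (Coalgebra.comul : C →ₗ[k] C ⊗[k] C)) (ρ m)) →
            (∀ m : M, (TensorProduct.rid k M)
                ((lTensor M (Coalgebra.counit : C →ₗ[k] k)) (ρ m)) = m) →
            ∀ N : Submodule k M,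
              (∀ n ∈ N, (lTensor M f.toLinearMap) (ρ n) ∈
                  LinearMap.range (TensorProduct.map N.subtype (LinearMap.id : D →ₗ[k] D))) →
              ∀ n ∈ N, ρ n ∈
                LinearMap.range (TensorProduct.map N.subtype (LinearMap.id : C →ₗ[k] C))) ∧
        (∀ (M M' : Type) [AddCommGroup M] [Module k M] [FiniteDimensional k M]
            [AddCommGroup M'] [Module k M'] [FiniteDimensional k M'],
          ∀ (ρ : M →ₗ[k] M ⊗[k] C) (ρ' : M' →ₗ[k] M' ⊗[k] C),
            (∀ m : M, (TensorProduct.assoc k M C C) ((rTensor C ρ) (ρ m)) =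
                (lTensor M (Coalgebra.comul : C →ₗ[k] C ⊗[k] C)) (ρ m)) →
            (∀ m : M, (TensorProduct.rid k M)
                ((lTensor M (Coalgebra.counit : C →ₗ[k] k)) (ρ m)) = m) →
            (∀ m : M', (TensorProduct.assoc k M' C C) ((rTensor C ρ') (ρ' m)) =
                (lTensor M' (Coalgebra.comul : C →ₗ[k] C ⊗[k] C)) (ρ' m)) →
            (∀ m : M', (TensorProduct.rid k M')
                ((lTensor M' (Coalgebra.counit : C →ₗ[k] k)) (ρ' m)) = m) →
            ∀ φ : M →ₗ[k] M',
              (lTensor M' f.toLinearMap) ∘ₗ ρ' ∘ₗ φ = (TensorProduct.map φ f.toLinearMap) ∘ₗ ρ →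
              ρ' ∘ₗ φ = (TensorProduct.map φ (LinearMap.id : C →ₗ[k] C)) ∘ₗ ρ)) := by
  constructor
  · intro hf
    obtain ⟨g, hg⟩ := LinearMap.exists_leftInverse_of_injective f.toLinearMap
      (LinearMap.ker_eq_bot.2 hf)
    refine ⟨?_, ?_⟩
    · intro M _ _ _ ρ _ _ N hN n hn
      obtain ⟨y, hy⟩ := hN n hn
      refine ⟨lTensor N g y, ?_⟩
      have h := congrArg (lTensor M g) hy
      rw [← LinearMap.comp_apply (lTensor M g) (lTensor M f.toLinearMap), ← lTensor_comp, hg,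
        lTensor_id, LinearMap.id_apply] at h
      rw [← h]
      simp only [lTensor, ← LinearMap.comp_apply, ← TensorProduct.map_comp,
        LinearMap.id_comp, LinearMap.comp_id]
    · intro M M' _ _ _ _ _ _ ρ ρ' _ _ _ _ φ h
      have h' := congrArg (lTensor M' g ∘ₗ ·) h
      simpa only [← LinearMap.comp_assoc, lTensor, ← TensorProduct.map_comp, hg,
        LinearMap.id_comp, TensorProduct.map_id] using h'
  · rintro ⟨h, -⟩
    have slices (M : Type) [AddCommGroup M] [Module k M] [FiniteDimensional k M]
        (ρ : M →ₗ[k] M ⊗[k] C)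
        (hρ : ∀ m : M, (TensorProduct.assoc k M C C) ((rTensor C ρ) (ρ m)) =
          (lTensor M (Coalgebra.comul : C →ₗ[k] C ⊗[k] C)) (ρ m))
        (hε : ∀ m : M, (TensorProduct.rid k M)
          ((lTensor M (Coalgebra.counit : C →ₗ[k] k)) (ρ m)) = m)
        (m : M) (ψ : C →ₗ[k] k) :
        ∃ φ : D →ₗ[k] k, sliceRight (φ ∘ₗ f.toLinearMap) (ρ m) = sliceRight ψ (ρ m) := by
      obtain ⟨φ, hφ⟩ := mem_sliceSpan.1 (sliceRight_mem_of_mem_range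
        (h M ρ hρ hε _ (lTensor_coaction_mem_range_sliceSpan f ρ hρ m) m
          (mem_sliceSpan_coaction f ρ hε m)) ψ)
      exact ⟨φ, by rw [sliceRight_comp_apply, hφ]⟩
    obtain ⟨e, he⟩ : ∃ e, dualTensorHom k C C e = LinearMap.id :=
      ⟨_, (dualTensorHomEquiv k C C).apply_symm_apply LinearMap.id⟩
    have hdual (ψ : C →ₗ[k] k) : ∃ φ : D →ₗ[k] k, φ ∘ₗ f.toLinearMap = ψ := by
      obtain ⟨φ, hφ⟩ := slices (Module.Dual k C ⊗[k] C)
        (cofreeCoaction (k := k) (Module.Dual k C) C) (by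
          intro t
          exact cofreeCoaction_coassoc t) (by
          intro t
          exact cofreeCoaction_counit t) e ψ
      exact ⟨φ, eq_of_sliceRight_cofreeCoaction_eq he hφ⟩
    refine (injective_iff_map_eq_zero f).2 fun c hc => ?_
    refine (Module.forall_dual_apply_eq_zero_iff k c).1 fun ψ => ?_
    obtain ⟨φ, rfl⟩ := hdual ψ
    change φ (f c) = 0
    rw [hc, map_zero]
end

section
/- Let R be a commutative noetherian domain and f : A → B a homomorphism of R-algebras which are finitely generated and torsion-free as R-modules. Then f is surjective if and only if both of the following hold: (i) for every finitely generated B-module X and every A-submodule Y of X (viewing X as an A-module via restriction of scalars along f), Y is B-stable; and (ii) every A-linear map between finitely generated B-modules (viewed as A-modules via f) is B-linear. -/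
/-- **Lemma 4.** Let `R` be a commutative noetherian domain and `f : A → B` a
homomorphism of `R`-algebras which are finitely generated and torsion-free as
`R`-modules.  Then `f` is surjective iff (i) for every finitely generated `B`-module
`X` and every `A`-submodule `Y` of `X` (viewing `X` as an `A`-module via restriction
of scalars along `f`, so an `A`-submodule is an `R`-submodule stable under `f a • ·`),
`Y` is `B`-stable, and (ii) every `A`-linear map between finitely generated
`B`-modules is `B`-linear. -/
theorem statement3 (R A B : Type) [CommRing R] [IsDomain R] [IsNoetherianRing R]
    [Ring A] [Ring B] [Algebra R A] [Algebra R B]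
    [Module.Finite R A] [Module.Finite R B]
    [NoZeroSMulDivisors R A] [NoZeroSMulDivisors R B]
    (f : A →ₐ[R] B) :
    Function.Surjective f ↔
      ((∀ (X : Type) [AddCommGroup X] [Module R X] [Module B X] [IsScalarTower R B X]
          [Module.Finite B X],
          ∀ Y : Submodule R X, (∀ a : A, ∀ y ∈ Y, f a • y ∈ Y) →
            ∀ b : B, ∀ y ∈ Y, b • y ∈ Y) ∧
        (∀ (X X' : Type) [AddCommGroup X] [Module R X] [Module B X] [IsScalarTower R B X]
          [Module.Finite B X]
          [AddCommGroup X'] [Module R X'] [Module B X'] [IsScalarTower R B X']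
          [Module.Finite B X'],
          ∀ φ : X →ₗ[R] X', (∀ (a : A) (x : X), φ (f a • x) = f a • φ x) →
            ∀ (b : B) (x : X), φ (b • x) = b • φ x)) := by
  constructor
  · intro hf
    refine ⟨?_, ?_⟩
    · intro X _ _ _ _ _ Y hY b y hy
      obtain ⟨a, rfl⟩ := hf b
      exact hY a y hy
    · intro X X' _ _ _ _ _ _ _ _ _ _ φ hφ b x
      obtain ⟨a, rfl⟩ := hf b
      exact hφ a x
  · rintro ⟨hstable, -⟩ b
    have hrange : ∀ a : A, ∀ y ∈ LinearMap.range f.toLinearMap,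
        f a • y ∈ LinearMap.range f.toLinearMap := by
      rintro a _ ⟨c, rfl⟩
      exact ⟨a * c, map_mul f a c⟩
    obtain ⟨a, ha⟩ := hstable B _ hrange b 1 ⟨1, map_one f⟩
    exact ⟨a, by simpa using ha⟩
end

section
/- Let R be a commutative noetherian domain with fraction field K, and let f : A → B be a homomorphism of R-torsion-free R-algebras with B finitely generated as an R-module. Then the induced map f ⊗ id_K : A ⊗_R K → B ⊗_R K is surjective if and only if for every finitely generated R-torsion-free B-module M and every A-submodule N of M (viewing M as an A-module via restriction of scalars along f) such that M/N is R-torsion-free, the submodule N is B-stable. -/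
open TensorProduct in
/-- An `R`-linear map becomes surjective over the fraction field iff its cokernel is torsion. -/
theorem LinearMap.rTensor_fractionRing_surjective_iff {R K A B : Type*} [CommRing R] [IsDomain R]
    [Field K] [Algebra R K] [IsFractionRing R K] [AddCommGroup A] [AddCommGroup B]
    [Module R A] [Module R B] (f : A →ₗ[R] B) :
    Function.Surjective (f.rTensor K) ↔ ∀ b : B, ∃ r : R, r ≠ 0 ∧ r • b ∈ LinearMap.range f := by
  constructor
  · intro hf b
    obtain ⟨x, hx⟩ := hf (b ⊗ₜ 1)
    have hzero : (LinearMap.range f).mkQ b ⊗ₜ[R] (1 : K) = 0 := by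
      rw [← LinearMap.rTensor_tmul, ← hx, ← LinearMap.comp_apply, ← LinearMap.rTensor_comp,
        LinearMap.range_mkQ_comp, LinearMap.rTensor_zero, LinearMap.zero_apply]
    have hzero' : TensorProduct.mk R K (B ⧸ LinearMap.range f) 1
        ((LinearMap.range f).mkQ b) = 0 := by
      simpa using congrArg (TensorProduct.comm R _ K) hzero
    have : IsLocalizedModule (nonZeroDivisors R)
        (TensorProduct.mk R K (B ⧸ LinearMap.range f) 1) :=
      (isLocalizedModule_iff_isBaseChange (nonZeroDivisors R) K _).2
        (TensorProduct.isBaseChange R _ K)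
    obtain ⟨c, hc⟩ := (IsLocalizedModule.eq_zero_iff (nonZeroDivisors R) _).1 hzero'
    refine ⟨c, nonZeroDivisors.ne_zero c.2, ?_⟩
    rwa [Submonoid.smul_def, ← map_smul, Submodule.mkQ_apply,
      Submodule.Quotient.mk_eq_zero] at hc
  · intro h y
    induction y with
    | zero => exact ⟨0, map_zero _⟩
    | add x y hx hy =>
      obtain ⟨u, rfl⟩ := hx
      obtain ⟨v, rfl⟩ := hy
      exact ⟨u + v, map_add _ _ _⟩
    | tmul b k =>
      obtain ⟨r, hr, a, ha⟩ := h b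
      have hr' : algebraMap R K r ≠ 0 := by
        simpa using hr
      refine ⟨a ⊗ₜ ((algebraMap R K r)⁻¹ * k), ?_⟩
      rw [LinearMap.rTensor_tmul, ha, TensorProduct.smul_tmul, Algebra.smul_def,
        mul_inv_cancel_left₀ hr']

/-- The elements having a nonzero multiple in a given submodule. -/
def Submodule.saturation {R M : Type*} [CommRing R] [IsDomain R] [AddCommGroup M] [Module R M]
    (N : Submodule R M) : Submodule R M where
  carrier := {m | ∃ r : R, r ≠ 0 ∧ r • m ∈ N}
  zero_mem' := ⟨1, one_ne_zero, by simp⟩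
  add_mem' := by
    rintro x y ⟨r, hr, hx⟩ ⟨s, hs, hy⟩
    refine ⟨r * s, mul_ne_zero hr hs, ?_⟩
    rw [smul_add]
    refine N.add_mem ?_ ?_
    · rw [mul_comm, mul_smul]
      exact N.smul_mem s hx
    · rw [mul_smul]
      exact N.smul_mem r hy
  smul_mem' := by
    rintro c x ⟨r, hr, hx⟩
    exact ⟨r, hr, by rw [smul_comm]; exact N.smul_mem c hx⟩

theorem Submodule.mem_saturation {R M : Type*} [CommRing R] [IsDomain R] [AddCommGroup M]
    [Module R M] {N : Submodule R M} {m : M} :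
    m ∈ N.saturation ↔ ∃ r : R, r ≠ 0 ∧ r • m ∈ N :=
  Iff.rfl

theorem Submodule.mem_saturation_of_smul_mem {R M : Type*} [CommRing R] [IsDomain R]
    [AddCommGroup M] [Module R M] {N : Submodule R M} {r : R} (hr : r ≠ 0) {m : M}
    (h : r • m ∈ N.saturation) : m ∈ N.saturation := by
  obtain ⟨s, hs, h⟩ := h
  exact ⟨s * r, mul_ne_zero hs hr, by rwa [mul_smul]⟩


/-- **Proposition 5 (1), main equivalence.** Let `R` be a commutative noetherian domain
with fraction field `K` and `f : A → B` a homomorphism of `R`-torsion-free `R`-algebras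
with `B` finitely generated over `R`.  Then `f ⊗ id_K : A ⊗[R] K → B ⊗[R] K` is
surjective iff for every finitely generated `R`-torsion-free `B`-module `M` and every
`A`-submodule `N ⊆ M` (an `R`-submodule stable under `f a • ·`) such that `M/N` is
`R`-torsion-free, the submodule `N` is `B`-stable. -/
theorem statement4 (R K A B : Type) [CommRing R] [IsDomain R] [IsNoetherianRing R]
    [Field K] [Algebra R K] [IsFractionRing R K]
    [Ring A] [Ring B] [Algebra R A] [Algebra R B]
    [NoZeroSMulDivisors R A] [NoZeroSMulDivisors R B] [Module.Finite R B]
    (f : A →ₐ[R] B) :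
    Function.Surjective (LinearMap.rTensor K f.toLinearMap) ↔
      ∀ (M : Type) [AddCommGroup M] [Module R M] [Module B M] [IsScalarTower R B M]
        [Module.Finite B M] [NoZeroSMulDivisors R M],
        ∀ N : Submodule R M, (∀ a : A, ∀ n ∈ N, f a • n ∈ N) →
          NoZeroSMulDivisors R (M ⧸ N) →
          ∀ b : B, ∀ n ∈ N, b • n ∈ N := by
  have key := LinearMap.rTensor_fractionRing_surjective_iff (K := K) f.toLinearMap
  rw [key]
  constructor
  · intro h M _ _ _ _ _ _ N hN hsat b n hn
    obtain ⟨r, hr, a, ha⟩ := h b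
    have hmem : r • (b • n) ∈ N := by
      rw [← smul_assoc, ← ha]
      exact hN a n hn
    rw [← Submodule.Quotient.mk_eq_zero, Submodule.Quotient.mk_smul] at hmem
    exact (Submodule.Quotient.mk_eq_zero N).1
      ((eq_zero_or_eq_zero_of_smul_eq_zero hmem).resolve_left hr)
  · intro h b
    rw [← Submodule.mem_saturation]
    have hone : (1 : B) ∈ (LinearMap.range f.toLinearMap).saturation :=
      ⟨1, one_ne_zero, 1, by simp⟩
    have hb := h B (LinearMap.range f.toLinearMap).saturation ?_ ?_ b 1 hone
    · simpa using hb
    · rintro a n ⟨r, hr, c, hc⟩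
      refine ⟨r, hr, a * c, ?_⟩
      rw [← smul_comm, ← hc]
      simp
    · refine ⟨fun {r x} hx => ?_⟩
      induction x using Submodule.Quotient.induction_on with
      | H x =>
        rw [← Submodule.Quotient.mk_smul, Submodule.Quotient.mk_eq_zero] at hx
        rw [Submodule.Quotient.mk_eq_zero, or_iff_not_imp_left]
        exact fun hr => Submodule.mem_saturation_of_smul_mem hr hx
end

section
/- Let R be a commutative noetherian domain with fraction field K, and let f : A → B be a homomorphism of R-torsion-free R-algebras with B finitely generated as an R-module. If f ⊗ id_K : A ⊗_R K → B ⊗_R K is surjective, then for every finitely generated B-module M and every A-submodule N of M (viewing M as an A-module via restriction of scalars along f) such that M/N is R-torsion-free, the submodule N is B-stable. -/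
open TensorProduct in
/-- If `φ ⊗ id_K` is surjective for a fraction field `K` of `R`, then every element of the
codomain of `φ` has a nonzero `R`-multiple in the range of `φ`. -/
theorem exists_smul_mem_range_of_rTensor_surjective {R K P Q : Type*} [CommRing R] [IsDomain R]
    [Field K] [Algebra R K] [IsFractionRing R K] [AddCommGroup P] [AddCommGroup Q]
    [Module R P] [Module R Q] (φ : P →ₗ[R] Q)
    (hφ : Function.Surjective (LinearMap.rTensor K φ)) (q : Q) :
    ∃ r : R, r ≠ 0 ∧ r • q ∈ LinearMap.range φ := by
  obtain ⟨t, ht⟩ := hφ (q ⊗ₜ[R] (1 : K))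
  have hzero : (LinearMap.range φ).mkQ q ⊗ₜ[R] (1 : K) = 0 := by
    rw [← LinearMap.rTensor_tmul, ← ht, ← LinearMap.comp_apply, ← LinearMap.rTensor_comp,
      LinearMap.range_mkQ_comp, LinearMap.rTensor_zero, LinearMap.zero_apply]
  have hmk : TensorProduct.mk R K (Q ⧸ LinearMap.range φ) 1 ((LinearMap.range φ).mkQ q) = 0 := by
    simpa using congrArg (TensorProduct.comm R (Q ⧸ LinearMap.range φ) K) hzero
  obtain ⟨r, hr⟩ := (IsLocalizedModule.eq_zero_iff (nonZeroDivisors R) _).1 hmk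
  refine ⟨r, nonZeroDivisors.coe_ne_zero r, ?_⟩
  rwa [← Submodule.Quotient.mk_eq_zero]

/-- **Proposition 5 (1), complement.** Let `R` be a commutative noetherian domain with
fraction field `K` and `f : A → B` a dominant homomorphism of `R`-torsion-free
`R`-algebras with `B` finitely generated over `R` (i.e. `f ⊗ id_K` is surjective).
Then for every finitely generated `B`-module `M` (not necessarily torsion-free) and
every `A`-submodule `N ⊆ M` such that `M/N` is `R`-torsion-free, the submodule `N`
is `B`-stable. -/
theorem statement5 (R K A B : Type) [CommRing R] [IsDomain R] [IsNoetherianRing R]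
    [Field K] [Algebra R K] [IsFractionRing R K]
    [Ring A] [Ring B] [Algebra R A] [Algebra R B]
    [NoZeroSMulDivisors R A] [NoZeroSMulDivisors R B] [Module.Finite R B]
    (f : A →ₐ[R] B)
    (hdom : Function.Surjective (LinearMap.rTensor K f.toLinearMap)) :
    ∀ (M : Type) [AddCommGroup M] [Module R M] [Module B M] [IsScalarTower R B M]
      [Module.Finite B M],
      ∀ N : Submodule R M, (∀ a : A, ∀ n ∈ N, f a • n ∈ N) →
        NoZeroSMulDivisors R (M ⧸ N) →
        ∀ b : B, ∀ n ∈ N, b • n ∈ N := by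
  intro M _ _ _ _ _ N hN hMN b n hn
  obtain ⟨r, hr, a, ha⟩ := exists_smul_mem_range_of_rTensor_surjective f.toLinearMap hdom b
  have hmem : r • b • n ∈ N := by
    rw [← smul_assoc, ← ha]
    exact hN a n hn
  rw [← Submodule.Quotient.mk_eq_zero, Submodule.Quotient.mk_smul] at hmem
  exact (Submodule.Quotient.mk_eq_zero N).1 ((smul_eq_zero.1 hmem).resolve_left hr)
end

section
/- Let R be a commutative noetherian domain with fraction field K, and let f : A → B be a homomorphism of R-torsion-free R-algebras with B finitely generated as an R-module. If f ⊗ id_K : A ⊗_R K → B ⊗_R K is surjective, then every A-linear map φ : M → N between finitely generated R-torsion-free B-modules (viewed as A-modules via restriction of scalars along f) is B-linear. -/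
/-- If `g ⊗ id_K` is surjective, then every element of the codomain has a nonzero
multiple in the range of `g`. -/
theorem exists_apply_eq_smul_of_rTensor_surjective {R K P Q : Type*} [CommRing R] [IsDomain R]
    [Field K] [Algebra R K] [IsFractionRing R K] [AddCommGroup P] [Module R P]
    [AddCommGroup Q] [Module R Q] (g : P →ₗ[R] Q)
    (hg : Function.Surjective (LinearMap.rTensor K g)) (q : Q) :
    ∃ r : R, r ≠ 0 ∧ ∃ p : P, g p = r • q := by
  let π := (LinearMap.range g).mkQ
  obtain ⟨t, ht⟩ := hg (TensorProduct.tmul R q (1 : K))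
  have hπ : TensorProduct.tmul R (π q) (1 : K) = 0 := by
    have hcomp : π ∘ₗ g = 0 := LinearMap.range_mkQ_comp g
    rw [← LinearMap.rTensor_tmul, ← ht, ← LinearMap.comp_apply, ← LinearMap.rTensor_comp, hcomp,
      LinearMap.rTensor_zero, LinearMap.zero_apply]
  have hmk : TensorProduct.mk R K (Q ⧸ LinearMap.range g) 1 (π q) = 0 := by
    simpa using congrArg (TensorProduct.comm R _ _) hπ
  obtain ⟨r, hr⟩ := (IsLocalizedModule.eq_zero_iff (nonZeroDivisors R) _).mp hmk
  refine ⟨r, nonZeroDivisors.ne_zero r.2, ?_⟩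
  have hr' : π ((r : R) • q) = 0 := by rw [map_smul]; exact hr
  exact LinearMap.mem_range.mp ((Submodule.Quotient.mk_eq_zero _).mp hr')

/-- **Proposition 5 (1), fullness.** Let `R` be a commutative noetherian domain with
fraction field `K` and `f : A → B` a dominant homomorphism of `R`-torsion-free
`R`-algebras with `B` finitely generated over `R` (i.e. `f ⊗ id_K` is surjective).
Then every `A`-linear map `φ : M → N` between finitely generated `R`-torsion-free
`B`-modules (viewed as `A`-modules via restriction of scalars along `f`) is
`B`-linear. -/
theorem statement6 (R K A B : Type) [CommRing R] [IsDomain R] [IsNoetherianRing R]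
    [Field K] [Algebra R K] [IsFractionRing R K]
    [Ring A] [Ring B] [Algebra R A] [Algebra R B]
    [NoZeroSMulDivisors R A] [NoZeroSMulDivisors R B] [Module.Finite R B]
    (f : A →ₐ[R] B)
    (hdom : Function.Surjective (LinearMap.rTensor K f.toLinearMap)) :
    ∀ (M N : Type) [AddCommGroup M] [Module R M] [Module B M] [IsScalarTower R B M]
      [Module.Finite B M] [NoZeroSMulDivisors R M]
      [AddCommGroup N] [Module R N] [Module B N] [IsScalarTower R B N]
      [Module.Finite B N] [NoZeroSMulDivisors R N],
      ∀ φ : M →ₗ[R] N, (∀ (a : A) (x : M), φ (f a • x) = f a • φ x) →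
        ∀ (b : B) (x : M), φ (b • x) = b • φ x := by
  intro M N _ _ _ _ _ _ _ _ _ _ _ _ φ hφ b x
  obtain ⟨r, hr, a, ha⟩ := exists_apply_eq_smul_of_rTensor_surjective f.toLinearMap hdom b
  have ha' : f a = r • b := ha
  have h := hφ a x
  rw [ha', smul_assoc, smul_assoc, map_smul] at h
  exact smul_right_injective N hr h
end

section
/- Let R be a commutative noetherian domain, and let f : A → B be a homomorphism of R-torsion-free R-algebras with B finitely generated as an R-module. Then f is surjective if and only if for every finitely generated R-torsion-free B-module M and every A-submodule N of M (viewing M as an A-module via restriction of scalars along f), the submodule N is B-stable. -/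
/-- **Proposition 5 (2).** Let `R` be a commutative noetherian domain and `f : A → B`
a homomorphism of `R`-torsion-free `R`-algebras with `B` finitely generated over `R`.
Then `f` is surjective iff for every finitely generated `R`-torsion-free `B`-module
`M` and every `A`-submodule `N ⊆ M` (an `R`-submodule stable under `f a • ·`), the
submodule `N` is `B`-stable. -/
theorem statement7 (R A B : Type) [CommRing R] [IsDomain R] [IsNoetherianRing R]
    [Ring A] [Ring B] [Algebra R A] [Algebra R B]
    [NoZeroSMulDivisors R A] [NoZeroSMulDivisors R B] [Module.Finite R B]
    (f : A →ₐ[R] B) :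
    Function.Surjective f ↔
      ∀ (M : Type) [AddCommGroup M] [Module R M] [Module B M] [IsScalarTower R B M]
        [Module.Finite B M] [NoZeroSMulDivisors R M],
        ∀ N : Submodule R M, (∀ a : A, ∀ n ∈ N, f a • n ∈ N) →
          ∀ b : B, ∀ n ∈ N, b • n ∈ N := by
  constructor
  · intro hf M _ _ _ _ _ _ N hN b n hn
    obtain ⟨a, rfl⟩ := hf b
    exact hN a n hn
  · intro h b
    have hb := h B (LinearMap.range f.toLinearMap)
      (by rintro a _ ⟨a', rfl⟩; exact ⟨a * a', by simp⟩) b 1 ⟨1, by simp⟩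
    simpa using hb
end

section
/- Let R be a commutative noetherian domain with fraction field K. Let C be a finitely generated projective R-module, D a projective R-module, and f : C → D an R-linear map. Then f is injective if and only if the dual map f^∨ : D^∨ → C^∨ (where M^∨ = Hom_R(M, R)) becomes surjective after tensoring with K, i.e. f^∨ ⊗ id_K : D^∨ ⊗_R K → C^∨ ⊗_R K is surjective. -/
open scoped TensorProduct

/-- A linear form on the source of an injective map extends to the target after extending scalars
to the fraction field. -/
theorem LinearMap.exists_extend_fractionRing {R : Type*} (K : Type*) {C D : Type*} [CommRing R]
    [IsDomain R] [Field K] [Algebra R K] [IsFractionRing R K] [AddCommGroup C] [Module R C]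
    [AddCommGroup D] [Module R D] (g : C →ₗ[R] D) (hg : Function.Injective g) (φ : C →ₗ[R] R) :
    ∃ Ψ : D →ₗ[R] K, ∀ c, Ψ (g c) = algebraMap R K (φ c) := by
  have : Module.Flat R K := IsLocalization.flat K (nonZeroDivisors R)
  have hinj : Function.Injective (g.baseChange K) :=
    Module.Flat.lTensor_preserves_injective_linearMap g hg
  obtain ⟨l, hl⟩ := (g.baseChange K).exists_leftInverse_of_injective (LinearMap.ker_eq_bot.2 hinj)
  let θ : K ⊗[R] C →ₗ[K] K :=
    (TensorProduct.AlgebraTensorModule.rid R K K).toLinearMap ∘ₗ φ.baseChange K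
  refine ⟨((θ ∘ₗ l).restrictScalars R) ∘ₗ TensorProduct.mk R K D 1, fun c => ?_⟩
  have h := LinearMap.congr_fun hl (1 ⊗ₜ[R] c)
  simp only [LinearMap.comp_apply, LinearMap.baseChange_tmul, LinearMap.id_apply] at h
  simp [h, θ, Algebra.smul_def]

/-- A linear form on a finite module which embeds in a projective module `D` extends to `D` up to
a nonzero scalar. -/
theorem LinearMap.exists_smul_eq_dualMap {R C D : Type*} [CommRing R] [IsDomain R]
    [AddCommGroup C] [Module R C] [Module.Finite R C] [AddCommGroup D] [Module R D]
    [Module.Projective R D] (f : C →ₗ[R] D) (hf : Function.Injective f) (φ : Module.Dual R C) :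
    ∃ r : R, r ≠ 0 ∧ ∃ ψ : Module.Dual R D, f.dualMap ψ = r • φ := by
  classical
  obtain ⟨s, hs⟩ := Module.Projective.out (R := R) (P := D)
  obtain ⟨Ψ, hΨ⟩ := LinearMap.exists_extend_fractionRing (FractionRing R) (s ∘ₗ f)
    (hs.injective.comp hf) φ
  obtain ⟨T, hT⟩ := Module.Finite.fg_top (R := R) (M := C)
  let S : Finset D := T.biUnion fun t => (s (f t)).support
  obtain ⟨r, hr⟩ := IsLocalization.exist_integer_multiples (nonZeroDivisors R) S
    fun d => Ψ (Finsupp.single d 1)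
  choose! a ha using hr
  refine ⟨r, nonZeroDivisors.coe_ne_zero r,
    Finsupp.linearCombination R a ∘ₗ s, ?_⟩
  refine LinearMap.ext_on hT fun t ht => ?_
  apply IsFractionRing.injective R (FractionRing R)
  have hΨt := hΨ t
  have hsum : s (f t) = (s (f t)).sum fun d b => b • Finsupp.single d (1 : R) := by
    simp
  rw [LinearMap.comp_apply, hsum, map_finsuppSum] at hΨt
  simp only [LinearMap.dualMap_apply, LinearMap.comp_apply, LinearMap.smul_apply, smul_eq_mul,
    map_mul, ← hΨt, Finsupp.linearCombination_apply, Finsupp.sum, map_sum, Finset.mul_sum]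
  refine Finset.sum_congr rfl fun d hd => ?_
  rw [ha d (Finset.mem_biUnion.2 ⟨t, ht, hd⟩), map_smul, Algebra.smul_def, Algebra.smul_def]
  ring


/-- **Lemma 6 (1).** Let `R` be a commutative noetherian domain with fraction field
`K`, `C` a finitely generated projective `R`-module, `D` a projective `R`-module and
`f : C → D` an `R`-linear map.  Then `f` is injective iff the dual map
`f^∨ : D^∨ → C^∨` is dominant, i.e. `f^∨ ⊗ id_K` is surjective. -/
theorem statement8 (R K C D : Type) [CommRing R] [IsDomain R] [IsNoetherianRing R]
    [Field K] [Algebra R K] [IsFractionRing R K]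
    [AddCommGroup C] [Module R C] [Module.Finite R C] [Module.Projective R C]
    [AddCommGroup D] [Module R D] [Module.Projective R D]
    (f : C →ₗ[R] D) :
    Function.Injective f ↔
      Function.Surjective (LinearMap.rTensor K f.dualMap) := by
  constructor
  · intro hf y
    induction y with
    | zero => exact ⟨0, map_zero _⟩
    | add x y hx hy =>
      obtain ⟨a, rfl⟩ := hx
      obtain ⟨b, rfl⟩ := hy
      exact ⟨a + b, map_add _ _ _⟩
    | tmul φ k =>
      obtain ⟨r, hr, ψ, hψ⟩ := f.exists_smul_eq_dualMap hf φ
      have hr' : algebraMap R K r ≠ 0 := by simpa using hr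
      refine ⟨ψ ⊗ₜ[R] ((algebraMap R K r)⁻¹ * k), ?_⟩
      rw [LinearMap.rTensor_tmul, hψ, TensorProduct.smul_tmul, Algebra.smul_def,
        mul_inv_cancel_left₀ hr']
  · intro h
    refine (injective_iff_map_eq_zero f).2 fun x hx => ?_
    refine (Module.forall_dual_apply_eq_zero_iff R x).1 fun φ => ?_
    let ev : Module.Dual R C ⊗[R] K →ₗ[R] K :=
      (TensorProduct.lid R K).toLinearMap ∘ₗ LinearMap.rTensor K (Module.Dual.eval R C x)
    have hev : ev ∘ₗ LinearMap.rTensor K f.dualMap = 0 := by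
      ext ψ
      simp [ev, hx]
    obtain ⟨z, hz⟩ := h (φ ⊗ₜ[R] 1)
    have hφ : ev (φ ⊗ₜ[R] 1) = 0 := by
      rw [← hz]
      exact LinearMap.congr_fun hev z
    simpa [ev, Algebra.smul_def] using hφ
end

section
/- Let R be a commutative noetherian domain. Let C be a finitely generated projective R-module, D a projective R-module, and f : C → D an R-linear map. Then f is injective with R-flat cokernel (i.e. D/f(C) is a flat R-module, equivalently f is a pure monomorphism of R-modules) if and only if the dual map f^∨ : D^∨ → C^∨ (where M^∨ = Hom_R(M, R)) is surjective. -/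
namespace Module

variable {R C D : Type*} [CommRing R] [AddCommGroup C] [Module R C] [AddCommGroup D] [Module R D]

/-- The identity of a projective module agrees, on any finitely generated submodule, with an
endomorphism factoring through a finite free module. -/
theorem Projective.exists_factorization_id_on_fg [Projective R D] {N : Submodule R D}
    (hN : N.FG) :
    ∃ (T : Finset D) (α : D →ₗ[R] T →₀ R) (β : (T →₀ R) →ₗ[R] D), ∀ d ∈ N, β (α d) = d := by
  classical
  obtain ⟨S, rfl⟩ := hN
  obtain ⟨s, hs⟩ := projective_def.mp ‹Projective R D›
  let T := S.biUnion fun d ↦ (s d).support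
  let α := Finsupp.lcomapDomain (R := R) (M := R) (Subtype.val : T → D) Subtype.val_injective ∘ₗ s
  let β := Finsupp.linearCombination R (Subtype.val : T → D)
  refine ⟨T, α, β, fun d hd ↦ ?_⟩
  suffices h : Submodule.span R (S : Set D) ≤ LinearMap.eqLocus (β ∘ₗ α) .id from h hd
  refine Submodule.span_le.mpr fun d hd ↦ ?_
  have hsub : ((s d).support : Set D) ⊆ Set.range (Subtype.val : T → D) := fun x hx ↦
    ⟨⟨x, Finset.mem_biUnion.mpr ⟨d, hd, hx⟩⟩, rfl⟩
  have hmap : Finsupp.mapDomain Subtype.val (α d) = s d :=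
    Finsupp.mapDomain_comapDomain _ Subtype.val_injective _ hsub
  calc β (α d)
    _ = Finsupp.linearCombination R id (Finsupp.mapDomain Subtype.val (α d)) := by
        rw [Finsupp.linearCombination_mapDomain]; rfl
    _ = d := by rw [hmap, hs]

/-- An injection of a finitely generated module into a projective module splits if its cokernel
is flat. -/
theorem exists_leftInverse_of_flat_quotient_range [Module.Finite R C] [Projective R D]
    {f : C →ₗ[R] D} (hf : Function.Injective f) [Flat R (D ⧸ LinearMap.range f)] :
    ∃ r : D →ₗ[R] C, r ∘ₗ f = .id := by
  obtain ⟨T, α, β, hαβ⟩ := Projective.exists_factorization_id_on_fg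
    (R := R) (N := LinearMap.range f) (Finite.iff_fg.mp inferInstance)
  let K := LinearMap.range (α ∘ₗ f)
  have : FinitePresentation R ((T →₀ R) ⧸ K) :=
    finitePresentation_of_surjective K.mkQ K.mkQ_surjective
      (by rw [K.ker_mkQ]; exact Finite.iff_fg.mp inferInstance)
  have hK : K ≤ LinearMap.ker ((LinearMap.range f).mkQ ∘ₗ β) := by
    rintro _ ⟨c, rfl⟩
    simp [hαβ (f c) ⟨c, rfl⟩]
  obtain ⟨k, u, v, huv⟩ := Flat.exists_factorization_of_finitePresentation (K.liftQ _ hK)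
  obtain ⟨h, hh⟩ := projective_lifting_property (LinearMap.range f).mkQ v
    (Submodule.mkQ_surjective _)
  let γ := β - h ∘ₗ u ∘ₗ K.mkQ
  have hγ : ∀ x, γ x ∈ LinearMap.range f := fun x ↦ by
    have h₁ := LinearMap.congr_fun huv (K.mkQ x)
    have h₂ := LinearMap.congr_fun hh (u (K.mkQ x))
    rw [← (LinearMap.range f).ker_mkQ, LinearMap.mem_ker]
    change (LinearMap.range f).mkQ (β x - h (u (K.mkQ x))) = 0
    rw [map_sub, sub_eq_zero]
    exact h₁.trans h₂.symm
  refine ⟨(LinearEquiv.ofInjective f hf).symm ∘ₗ γ.codRestrict _ hγ ∘ₗ α, LinearMap.ext fun c ↦ ?_⟩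
  have hc : K.mkQ (α (f c)) = 0 := (Submodule.Quotient.mk_eq_zero _).mpr ⟨c, rfl⟩
  refine (LinearEquiv.ofInjective f hf).symm_apply_eq.mpr (Subtype.ext ?_)
  change β (α (f c)) - h (u (K.mkQ (α (f c)))) = f c
  rw [hc, map_zero, map_zero, sub_zero, hαβ _ ⟨c, rfl⟩]

/-- A linear map out of a finitely generated projective module whose dual is surjective splits. -/
theorem exists_leftInverse_of_dualMap_surjective [Module.Finite R C] [Projective R C]
    {f : C →ₗ[R] D} (hf : Function.Surjective f.dualMap) :
    ∃ r : D →ₗ[R] C, r ∘ₗ f = .id := by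
  obtain ⟨n, p, g, -, -, hpg⟩ := Finite.exists_comp_eq_id_of_projective R C
  choose ψ hψ using fun i : Fin n ↦ hf (LinearMap.proj i ∘ₗ g)
  refine ⟨p ∘ₗ LinearMap.pi ψ, ?_⟩
  rw [LinearMap.comp_assoc, ← hpg]
  congr 1
  ext c i
  exact LinearMap.congr_fun (hψ i) c

theorem Flat.quotient_range_of_leftInverse [Flat R D] {f : C →ₗ[R] D} {r : D →ₗ[R] C}
    (hr : r ∘ₗ f = .id) : Flat R (D ⧸ LinearMap.range f) := by
  have hr' (c : C) : r (f c) = c := LinearMap.congr_fun hr c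
  refine .of_retract ((LinearMap.range f).liftQ (.id - f ∘ₗ r) ?_) (LinearMap.range f).mkQ ?_
  · rintro _ ⟨c, rfl⟩
    simp [hr']
  · ext d
    simp

end Module


/-- **Lemma 6 (2).** Let `R` be a commutative noetherian domain, `C` a finitely
generated projective `R`-module, `D` a projective `R`-module and `f : C → D` an
`R`-linear map.  Then `f` is injective and pure (i.e. injective with `D/f(C)` a flat
`R`-module) iff the dual map `f^∨ : D^∨ → C^∨` is surjective. -/
theorem statement9 (R C D : Type) [CommRing R] [IsDomain R] [IsNoetherianRing R]
    [AddCommGroup C] [Module R C] [Module.Finite R C] [Module.Projective R C]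
    [AddCommGroup D] [Module R D] [Module.Projective R D]
    (f : C →ₗ[R] D) :
    (Function.Injective f ∧ Module.Flat R (D ⧸ LinearMap.range f)) ↔
      Function.Surjective f.dualMap := by
  constructor
  · rintro ⟨hf, _⟩ φ
    obtain ⟨r, hr⟩ := Module.exists_leftInverse_of_flat_quotient_range hf
    exact ⟨φ ∘ₗ r, by
      rw [LinearMap.dualMap_apply', LinearMap.comp_assoc, hr, LinearMap.comp_id]⟩
  · intro hf
    obtain ⟨r, hr⟩ := Module.exists_leftInverse_of_dualMap_surjective hf
    exact ⟨LinearMap.injective_of_comp_eq_id _ _ hr, Module.Flat.quotient_range_of_leftInverse hr⟩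
end

section
/- Let R be a commutative integral domain, M an R-module, and P a flat R-module. Then the torsion submodule of M ⊗_R P equals the image of the canonical map M^tor ⊗_R P → M ⊗_R P, where M^tor denotes the torsion submodule of M. -/
open TensorProduct

/-- Elements of `M ⊗[R] P` killed by `a`, with `P` flat, come from the `a`-torsion of `M`. -/
theorem torsionBy_tensorProduct_le_range {R M P : Type*} [CommRing R]
    [AddCommGroup M] [Module R M] [AddCommGroup P] [Module R P] [Module.Flat R P] (a : R) :
    Submodule.torsionBy R (M ⊗[R] P) a ≤
      LinearMap.range ((Submodule.torsionBy R M a).subtype.rTensor P) := by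
  intro x hx
  have hexact : Function.Exact (Submodule.torsionBy R M a).subtype (LinearMap.lsmul R M a) := by
    intro m
    simp [Submodule.mem_torsionBy_iff]
  have hsmul : (LinearMap.lsmul R M a).rTensor P = LinearMap.lsmul R (M ⊗[R] P) a :=
    TensorProduct.ext' fun m p ↦ by simp [TensorProduct.smul_tmul']
  refine (Module.Flat.rTensor_exact P hexact x).mp ?_
  rw [hsmul]
  exact hx

/-- Let `R` be a commutative integral domain, `M` an `R`-module and `P` a flat
`R`-module.  Then the torsion submodule of `M ⊗[R] P` equals the image of the
canonical map `M^tor ⊗[R] P → M ⊗[R] P`. -/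
theorem statement11 (R M P : Type) [CommRing R] [IsDomain R]
    [AddCommGroup M] [Module R M] [AddCommGroup P] [Module R P] [Module.Flat R P] :
    Submodule.torsion R (M ⊗[R] P) =
      LinearMap.range (TensorProduct.map (Submodule.torsion R M).subtype
        (LinearMap.id : P →ₗ[R] P)) := by
  apply le_antisymm
  · intro x hx
    obtain ⟨a, ha⟩ := (Submodule.mem_torsion_iff x).mp hx
    have hle : Submodule.torsionBy R M (a : R) ≤ Submodule.torsion R M :=
      fun m hm ↦ (Submodule.mem_torsion_iff m).mpr ⟨a, hm⟩
    obtain ⟨y, rfl⟩ := torsionBy_tensorProduct_le_range (a : R) ha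
    refine ⟨(Submodule.inclusion hle).rTensor P y, ?_⟩
    change (Submodule.torsion R M).subtype.rTensor P _ = _
    rw [← LinearMap.rTensor_comp_apply, Submodule.subtype_comp_inclusion]
  · rintro _ ⟨y, rfl⟩
    induction y with
    | zero => simp
    | add y z hy hz =>
      rw [map_add]
      exact add_mem hy hz
    | tmul m p =>
      obtain ⟨a, ha⟩ := (Submodule.mem_torsion_iff (m : M)).mp m.2
      refine (Submodule.mem_torsion_iff _).mpr ⟨a, ?_⟩
      rw [TensorProduct.map_tmul, Submonoid.smul_def, TensorProduct.smul_tmul',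
        Submodule.subtype_apply, ← Submonoid.smul_def, ha, TensorProduct.zero_tmul]
end

section
/- Let R be a commutative integral domain and C a flat R-coalgebra. Let (M, ρ) be a right C-comodule. Then the torsion submodule M^tor of M is a subcomodule: ρ(M^tor) is contained in the image of M^tor ⊗ C in M ⊗ C. -/
open TensorProduct LinearMap

/-- If `C` is flat, every element of `M ⊗ C` annihilated by a scalar `a` comes from
`N ⊗ C` for any submodule `N` containing the `a`-torsion of `M`. -/
theorem mem_range_map_subtype_of_smul_eq_zero {R C M : Type*} [CommRing R]
    [AddCommGroup C] [Module R C] [Module.Flat R C] [AddCommGroup M] [Module R M]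
    {N : Submodule R M} {a : R} (hN : ∀ m : M, a • m = 0 → m ∈ N)
    {x : M ⊗[R] C} (hx : a • x = 0) :
    x ∈ LinearMap.range (TensorProduct.map N.subtype (LinearMap.id : C →ₗ[R] C)) := by
  have hker : (LinearMap.lsmul R M a).ker ≤ N := fun m hm => hN m hm
  have hexact := Module.Flat.rTensor_exact C
    (LinearMap.exact_subtype_ker_map (LinearMap.lsmul R M a))
  have hsmul : (LinearMap.lsmul R M a).rTensor C = LinearMap.lsmul R (M ⊗[R] C) a :=
    TensorProduct.ext' fun _ _ => rfl
  obtain ⟨y, rfl⟩ := (hexact x).mp (by rw [hsmul]; exact hx)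
  refine ⟨(Submodule.inclusion hker).rTensor C y, ?_⟩
  change N.subtype.rTensor C ((Submodule.inclusion hker).rTensor C y) = _
  rw [← LinearMap.rTensor_comp_apply]
  rfl

/-- Let `R` be a commutative integral domain, `C` a flat `R`-coalgebra and `(M, ρ)` a
right `C`-comodule.  Then the torsion submodule `M^tor` of `M` is a subcomodule:
`ρ(M^tor)` is contained in the image of `M^tor ⊗ C` in `M ⊗ C`. -/
theorem statement12 (R C M : Type) [CommRing R] [IsDomain R]
    [AddCommGroup C] [Module R C] [Coalgebra R C] [Module.Flat R C]
    [AddCommGroup M] [Module R M] (ρ : M →ₗ[R] M ⊗[R] C)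
    (hcoassoc : ∀ m : M, (TensorProduct.assoc R M C C) ((rTensor C ρ) (ρ m)) =
        (lTensor M (Coalgebra.comul : C →ₗ[R] C ⊗[R] C)) (ρ m))
    (hcounit : ∀ m : M, (TensorProduct.rid R M)
        ((lTensor M (Coalgebra.counit : C →ₗ[R] R)) (ρ m)) = m) :
    ∀ m ∈ Submodule.torsion R M,
      ρ m ∈ LinearMap.range (TensorProduct.map (Submodule.torsion R M).subtype
        (LinearMap.id : C →ₗ[R] C)) := by
  rintro m ⟨a, ha⟩
  have ham : (a : R) • m = 0 := ha
  refine mem_range_map_subtype_of_smul_eq_zero (a := (a : R))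
    (fun n hn => (Submodule.mem_torsion_iff n).mpr ⟨a, hn⟩) ?_
  rw [← map_smul, ham, map_zero]
end

section
/- Let R be a commutative ring, let C ⊆ D be an inclusion of flat R-modules such that D/C is flat (i.e. the inclusion is pure), and let N ⊆ M be an inclusion of R-modules. Then inside M ⊗_R D, the intersection of the image of N ⊗_R D and the image of M ⊗_R C equals the image of N ⊗_R C. -/
/-- Let `R` be a commutative ring, `C ⊆ D` an inclusion of flat `R`-modules with
`D/C` flat (i.e. the inclusion is pure), and `N ⊆ M` an inclusion of `R`-modules.
Then inside `M ⊗[R] D` the intersection of the image of `N ⊗[R] D` and the image of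
`M ⊗[R] C` equals the image of `N ⊗[R] C`. -/
theorem statement13 (R M D : Type) [CommRing R]
    [AddCommGroup M] [Module R M] [AddCommGroup D] [Module R D] [Module.Flat R D]
    (C : Submodule R D) [Module.Flat R C] [Module.Flat R (D ⧸ C)]
    (N : Submodule R M) :
    (LinearMap.range (TensorProduct.map N.subtype (LinearMap.id : D →ₗ[R] D)) ⊓
        LinearMap.range (TensorProduct.map (LinearMap.id : M →ₗ[R] M) C.subtype)) =
      LinearMap.range (TensorProduct.map N.subtype C.subtype) := by
  apply le_antisymm
  · rintro z ⟨⟨y, rfl⟩, ⟨w, hw⟩⟩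
    have hexact : Function.Exact C.subtype C.mkQ := LinearMap.exact_subtype_mkQ C
    have hy : C.mkQ.lTensor N y = 0 := by
      apply Module.Flat.rTensor_preserves_injective_linearMap (M := D ⧸ C) N.subtype
        N.injective_subtype
      calc N.subtype.rTensor (D ⧸ C) (C.mkQ.lTensor N y)
          = C.mkQ.lTensor M (N.subtype.rTensor D y) := by
            rw [← LinearMap.comp_apply, ← LinearMap.comp_apply, LinearMap.rTensor_comp_lTensor,
              LinearMap.lTensor_comp_rTensor]
        _ = C.mkQ.lTensor M (C.subtype.lTensor M w) := congrArg (C.mkQ.lTensor M) hw.symm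
        _ = 0 := (lTensor_exact M hexact C.mkQ_surjective).apply_apply_eq_zero w
        _ = N.subtype.rTensor (D ⧸ C) 0 := (map_zero _).symm
    obtain ⟨x, rfl⟩ := (lTensor_exact N hexact C.mkQ_surjective y).mp hy
    refine ⟨x, ?_⟩
    rw [← LinearMap.rTensor_comp_lTensor]
    rfl
  · apply le_inf
    · rw [← LinearMap.rTensor_comp_lTensor]
      exact LinearMap.range_comp_le_range _ _
    · rw [← LinearMap.lTensor_comp_rTensor]
      exact LinearMap.range_comp_le_range _ _
end

section
/- Let R be a commutative noetherian domain and let f : C → D be a homomorphism of flat R-coalgebras. Then f is injective if and only if for every R-torsion-free right C-comodule (M, ρ) and every R-submodule N ⊆ M with M/N R-torsion-free which is a D-subcomodule via f (i.e. (id_M ⊗ f)∘ρ maps N into the image of N ⊗ D in M ⊗ D), the submodule N is C-stable (i.e. ρ(N) is contained in the image of N ⊗ C in M ⊗ C). -/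
open TensorProduct LinearMap

/-- A torsion-free module over a domain embeds into its localization at the nonzero elements. -/
theorem injective_mkLinearMap_nonZeroDivisors (R Q : Type*) [CommRing R] [IsDomain R]
    [AddCommGroup Q] [Module R Q] [NoZeroSMulDivisors R Q] :
    Function.Injective (LocalizedModule.mkLinearMap (nonZeroDivisors R) Q) := by
  rw [injective_iff_map_eq_zero]
  intro q hq
  obtain ⟨c, hc⟩ := (IsLocalizedModule.eq_zero_iff (nonZeroDivisors R)
    (LocalizedModule.mkLinearMap (nonZeroDivisors R) Q)).mp hq
  exact (eq_zero_or_eq_zero_of_smul_eq_zero (c := (c : R)) hc).resolve_left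
    (nonZeroDivisors.coe_ne_zero c)

/-- The localization of a module over a domain at the nonzero elements is flat. -/
theorem flat_localizedModule_nonZeroDivisors (R Q : Type*) [CommRing R] [IsDomain R]
    [AddCommGroup Q] [Module R Q] :
    Module.Flat R (LocalizedModule (nonZeroDivisors R) Q) := by
  have : Module.Flat R (FractionRing R) := IsLocalization.flat _ (nonZeroDivisors R)
  let _ : Module (FractionRing R) (LocalizedModule (nonZeroDivisors R) Q) :=
    inferInstanceAs (Module (Localization (nonZeroDivisors R)) _)
  have : IsScalarTower R (FractionRing R) (LocalizedModule (nonZeroDivisors R) Q) :=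
    inferInstanceAs (IsScalarTower R (Localization (nonZeroDivisors R)) _)
  exact Module.Flat.trans R (FractionRing R) _

/-- Over a domain, tensoring an injection out of a flat module with a torsion-free module
preserves injectivity. -/
theorem lTensor_injective_of_noZeroSMulDivisors {R C D : Type*} (Q : Type*) [CommRing R]
    [IsDomain R] [AddCommGroup C] [Module R C] [Module.Flat R C] [AddCommGroup D] [Module R D]
    [AddCommGroup Q] [Module R Q] [NoZeroSMulDivisors R Q]
    (f : C →ₗ[R] D) (hf : Function.Injective f) : Function.Injective (lTensor Q f) := by
  have := flat_localizedModule_nonZeroDivisors R Q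
  let i := LocalizedModule.mkLinearMap (nonZeroDivisors R) Q
  have h₁ : Function.Injective (rTensor C i) :=
    Module.Flat.rTensor_preserves_injective_linearMap i
      (injective_mkLinearMap_nonZeroDivisors R Q)
  have h₂ := Module.Flat.lTensor_preserves_injective_linearMap
    (M := LocalizedModule (nonZeroDivisors R) Q) f hf
  have h : rTensor D i ∘ₗ lTensor Q f = lTensor _ f ∘ₗ rTensor C i := by
    rw [rTensor_comp_lTensor, lTensor_comp_rTensor]
  refine Function.Injective.of_comp (f := rTensor D i) ?_
  rw [← coe_comp, h]
  exact h₂.comp h₁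

/-- An element of `M ⊗ C` comes from `N ⊗ C` iff it vanishes in `(M ⧸ N) ⊗ C`. -/
theorem mem_range_map_subtype_iff {R M C : Type*} [CommRing R] [AddCommGroup M] [Module R M]
    [AddCommGroup C] [Module R C] (N : Submodule R M) (x : M ⊗[R] C) :
    x ∈ LinearMap.range (TensorProduct.map N.subtype (LinearMap.id : C →ₗ[R] C)) ↔
      rTensor C N.mkQ x = 0 :=
  (rTensor_exact C (exact_subtype_mkQ N) N.mkQ_surjective x).symm

/-- For `D` flat, the kernel of `f ⊗ D` is the image of `ker f ⊗ D`. -/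
theorem mem_range_map_ker_subtype_iff {R M M' D : Type*} [CommRing R] [AddCommGroup M]
    [Module R M] [AddCommGroup M'] [Module R M'] [AddCommGroup D] [Module R D]
    [Module.Flat R D] (f : M →ₗ[R] M') (x : M ⊗[R] D) :
    x ∈ LinearMap.range (TensorProduct.map (ker f).subtype (LinearMap.id : D →ₗ[R] D)) ↔
      rTensor D f x = 0 :=
  (Module.Flat.rTensor_exact D (exact_subtype_ker_map f) x).symm

/-- **Proposition 9b (1), main equivalence.** Let `R` be a commutative noetherian
domain and `f : C → D` a homomorphism of flat `R`-coalgebras.  Then `f` is injective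
iff for every `R`-torsion-free right `C`-comodule `(M, ρ)` and every `R`-submodule
`N ⊆ M` with `M/N` torsion-free which is a `D`-subcomodule via `f` (i.e.
`(id_M ⊗ f) ∘ ρ` maps `N` into the image of `N ⊗ D` in `M ⊗ D`), the submodule `N`
is `C`-stable (i.e. `ρ(N)` lies in the image of `N ⊗ C` in `M ⊗ C`). -/
theorem statement14 (R C D : Type) [CommRing R] [IsDomain R] [IsNoetherianRing R]
    [AddCommGroup C] [Module R C] [Coalgebra R C] [Module.Flat R C]
    [AddCommGroup D] [Module R D] [Coalgebra R D] [Module.Flat R D]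
    (f : C →ₗc[R] D) :
    Function.Injective f ↔
      ∀ (M : Type) [AddCommGroup M] [Module R M] [NoZeroSMulDivisors R M],
        ∀ ρ : M →ₗ[R] M ⊗[R] C,
          (∀ m : M, (TensorProduct.assoc R M C C) ((rTensor C ρ) (ρ m)) =
              (lTensor M (Coalgebra.comul : C →ₗ[R] C ⊗[R] C)) (ρ m)) →
          (∀ m : M, (TensorProduct.rid R M)
              ((lTensor M (Coalgebra.counit : C →ₗ[R] R)) (ρ m)) = m) →
          ∀ N : Submodule R M, NoZeroSMulDivisors R (M ⧸ N) →
            (∀ n ∈ N, (lTensor M f.toLinearMap) (ρ n) ∈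
                LinearMap.range (TensorProduct.map N.subtype (LinearMap.id : D →ₗ[R] D))) →
            ∀ n ∈ N, ρ n ∈
              LinearMap.range (TensorProduct.map N.subtype (LinearMap.id : C →ₗ[R] C)) := by
  constructor
  · intro hf M _ _ _ ρ _ _ N hN hD n hn
    have hi := lTensor_injective_of_noZeroSMulDivisors (M ⧸ N) f.toLinearMap hf
    have h := (mem_range_map_subtype_iff N _).mp (hD n hn)
    rw [mem_range_map_subtype_iff]
    apply hi
    rw [map_zero, ← h, ← comp_apply (lTensor _ _), ← comp_apply (rTensor _ _),
      lTensor_comp_rTensor, rTensor_comp_lTensor]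
  · intro h
    have : NoZeroSMulDivisors R C := ⟨fun h => smul_eq_zero.mp h⟩
    have : NoZeroSMulDivisors R D := ⟨fun h => smul_eq_zero.mp h⟩
    let J := ker f.toLinearMap
    have hJ : NoZeroSMulDivisors R (C ⧸ J) :=
      (ker_eq_bot.mp (Submodule.ker_liftQ_eq_bot' J f.toLinearMap rfl)).noZeroSMulDivisors
        (J.liftQ f.toLinearMap le_rfl) (map_zero _) (map_smul _)
    have hstable := h C Coalgebra.comul Coalgebra.coassoc_apply
      (fun m => by simp [Coalgebra.lTensor_counit_comul]) J hJ (by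
        intro n hn
        rw [mem_range_map_ker_subtype_iff, ← comp_apply, rTensor_comp_lTensor]
        exact (CoalgHomClass.map_comp_comul_apply f n).trans
          (by rw [show f n = 0 from hn, map_zero]))
    rw [injective_iff_map_eq_zero]
    intro c hc
    obtain ⟨y, hy⟩ := hstable c hc
    have hε : Coalgebra.counit (R := R) (A := C) ∘ₗ J.subtype = 0 := by
      ext j
      have hj : f j = 0 := j.2
      simp [← CoalgHomClass.counit_comp_apply f, hj]
    have h1 := Coalgebra.rTensor_counit_comul (R := R) c
    rw [← hy, ← comp_apply, rTensor, ← TensorProduct.map_comp, hε, TensorProduct.map_zero_left,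
      LinearMap.zero_apply] at h1
    simpa using (congrArg (TensorProduct.lid R C) h1).symm
end

section
/- Let R be a commutative noetherian domain and let f : C → D be a homomorphism of flat R-coalgebras such that the induced map C/IC → D/ID fails to be injective for some ideal I of R (i.e. f is not a pure homomorphism of R-modules). Then the kernel C₀ of the induced map C ⊗_R R/I → D ⊗_R R/I is a nonzero submodule of the R/I-coalgebra C ⊗_R R/I which is stable under the coaction of D ⊗_R R/I but not stable under the coaction of C ⊗_R R/I; consequently there exists a C-comodule M and a D-subcomodule N ⊆ M (via f) which is not C-stable. -/
open TensorProduct LinearMap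

/-- Base change of a coaction: given `g : C → C ⊗ E` (e.g. the comultiplication of a
coalgebra `C`, or the `D`-coaction `(id ⊗ f) ∘ Δ` on `C` induced by a coalgebra map
`f : C → D`) and an `R`-module `Q` (e.g. `Q = R/I`), this is the induced coaction
`C ⊗ Q → (C ⊗ Q) ⊗ E`, obtained from `g ⊗ id_Q` by the canonical identification
`(C ⊗ E) ⊗ Q ≅ (C ⊗ Q) ⊗ E`.  Via the identification
`(C ⊗ Q) ⊗_{R/I} (E ⊗ Q) ≅ (C ⊗ Q) ⊗_R E` it encodes the coaction of the base-changed
coalgebra `E ⊗ R/I` on `C ⊗ R/I`. -/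
noncomputable def baseChangeCoaction (R C E Q : Type) [CommRing R]
    [AddCommGroup C] [Module R C] [AddCommGroup E] [Module R E]
    [AddCommGroup Q] [Module R Q] (g : C →ₗ[R] C ⊗[R] E) :
    C ⊗[R] Q →ₗ[R] (C ⊗[R] Q) ⊗[R] E :=
  (TensorProduct.assoc R C Q E).symm.toLinearMap ∘ₗ
    (lTensor C (TensorProduct.comm R E Q).toLinearMap) ∘ₗ
    (TensorProduct.assoc R C E Q).toLinearMap ∘ₗ rTensor Q g

section baseChangeCoaction

variable {R C D E F Q : Type} [CommRing R] [AddCommGroup C] [Module R C]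
  [AddCommGroup D] [Module R D] [AddCommGroup E] [Module R E] [AddCommGroup F] [Module R F]
  [AddCommGroup Q] [Module R Q]

theorem baseChangeCoaction_tmul (g : C →ₗ[R] C ⊗[R] E) (c : C) (q : Q) :
    baseChangeCoaction R C E Q g (c ⊗ₜ q) =
      rTensor E ((TensorProduct.mk R C Q).flip q) (g c) := by
  simp only [baseChangeCoaction, LinearMap.comp_apply, rTensor_tmul, LinearEquiv.coe_coe]
  induction g c with
  | zero => simp
  | add x y hx hy => simp only [add_tmul, map_add, hx, hy]
  | tmul a b => simp

theorem lTensor_baseChangeCoaction (g : C →ₗ[R] C ⊗[R] E) (h : E →ₗ[R] F) (x : C ⊗[R] Q) :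
    lTensor (C ⊗[R] Q) h (baseChangeCoaction R C E Q g x) =
      baseChangeCoaction R C F Q (lTensor C h ∘ₗ g) x := by
  induction x with
  | zero => simp
  | add x y hx hy => simp only [map_add, hx, hy]
  | tmul c q =>
    simp only [baseChangeCoaction_tmul, LinearMap.comp_apply]
    simp only [← LinearMap.comp_apply, ← LinearMap.comp_assoc, lTensor_comp_rTensor, rTensor_comp_lTensor]

/-- A map intertwining two coactions still intertwines them after base change. -/
theorem rTensor_baseChangeCoaction (g : C →ₗ[R] C ⊗[R] E) (g' : D →ₗ[R] D ⊗[R] E)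
    (h : C →ₗ[R] D) (hg : rTensor E h ∘ₗ g = g' ∘ₗ h) (x : C ⊗[R] Q) :
    rTensor E (rTensor Q h) (baseChangeCoaction R C E Q g x) =
      baseChangeCoaction R D E Q g' (rTensor Q h x) := by
  induction x with
  | zero => simp
  | add x y hx hy => simp only [map_add, hx, hy]
  | tmul c q =>
    have hgc : g' (h c) = rTensor E h (g c) := (LinearMap.congr_fun hg c).symm
    have hq : rTensor Q h ∘ₗ (TensorProduct.mk R C Q).flip q =
        (TensorProduct.mk R D Q).flip q ∘ₗ h := by
      ext; simp
    simp only [rTensor_tmul, baseChangeCoaction_tmul, hgc]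
    simp only [← LinearMap.comp_apply, ← LinearMap.comp_assoc, ← rTensor_comp, hq]

theorem baseChangeCoaction_comul_coassoc [Coalgebra R C] (x : C ⊗[R] Q) :
    TensorProduct.assoc R (C ⊗[R] Q) C C
        (rTensor C (baseChangeCoaction R C C Q Coalgebra.comul)
          (baseChangeCoaction R C C Q Coalgebra.comul x)) =
      lTensor (C ⊗[R] Q) Coalgebra.comul (baseChangeCoaction R C C Q Coalgebra.comul x) := by
  induction x with
  | zero => simp
  | add x y hx hy => simp only [map_add, hx, hy]
  | tmul c q =>
    have hq : baseChangeCoaction R C C Q Coalgebra.comul ∘ₗ (TensorProduct.mk R C Q).flip q =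
        rTensor C ((TensorProduct.mk R C Q).flip q) ∘ₗ Coalgebra.comul := by
      ext c; simp [baseChangeCoaction_tmul]
    have hassoc (y : (C ⊗[R] C) ⊗[R] C) :
        TensorProduct.assoc R (C ⊗[R] Q) C C
            (rTensor C (rTensor C ((TensorProduct.mk R C Q).flip q)) y) =
          rTensor (C ⊗[R] C) ((TensorProduct.mk R C Q).flip q)
            (TensorProduct.assoc R C C C y) := by
      rw [rTensor_tensor]
      simp
    rw [baseChangeCoaction_tmul, ← LinearMap.comp_apply (rTensor C _), ← rTensor_comp, hq,
      rTensor_comp, LinearMap.comp_apply, hassoc, Coalgebra.coassoc_apply]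
    simp only [← LinearMap.comp_apply, ← LinearMap.comp_assoc, lTensor_comp_rTensor, rTensor_comp_lTensor]

theorem baseChangeCoaction_comul_counit [Coalgebra R C] (x : C ⊗[R] Q) :
    TensorProduct.rid R (C ⊗[R] Q) (lTensor (C ⊗[R] Q) (Coalgebra.counit : C →ₗ[R] R)
      (baseChangeCoaction R C C Q Coalgebra.comul x)) = x := by
  induction x with
  | zero => simp
  | add x y hx hy => simp only [map_add, hx, hy]
  | tmul c q =>
    rw [baseChangeCoaction_tmul, ← LinearMap.comp_apply, lTensor_comp_rTensor,
      ← rTensor_comp_lTensor, LinearMap.comp_apply, Coalgebra.lTensor_counit_comul]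
    simp

/-- The left counit law for the base-changed comultiplication. -/
theorem rTensor_counit_baseChangeCoaction_comul [Coalgebra R C] (x : C ⊗[R] Q) :
    rTensor C (rTensor Q (Coalgebra.counit : C →ₗ[R] R))
        (baseChangeCoaction R C C Q Coalgebra.comul x) =
      rTensor C (TensorProduct.lid R Q).symm.toLinearMap (TensorProduct.comm R C Q x) := by
  induction x with
  | zero => simp
  | add x y hx hy => simp only [map_add, hx, hy]
  | tmul c q =>
    have hq : rTensor Q (Coalgebra.counit : C →ₗ[R] R) ∘ₗ (TensorProduct.mk R C Q).flip q =
        (TensorProduct.mk R R Q).flip q ∘ₗ Coalgebra.counit := by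
      ext; simp
    rw [baseChangeCoaction_tmul, ← LinearMap.comp_apply, ← rTensor_comp, hq, rTensor_comp,
      LinearMap.comp_apply, Coalgebra.rTensor_counit_comul]
    simp

/-- The kernel of the base change of a coalgebra map `f : C → D` to `Q` is a `D`-subcomodule. -/
theorem baseChangeCoaction_mem_range_of_mem_ker [Coalgebra R C] [Coalgebra R D]
    [Module.Flat R D] (f : C →ₗc[R] D) {x : C ⊗[R] Q}
    (hx : x ∈ LinearMap.ker (rTensor Q f.toLinearMap)) :
    baseChangeCoaction R C D Q (lTensor C f.toLinearMap ∘ₗ Coalgebra.comul) x ∈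
      LinearMap.range (TensorProduct.map
        (LinearMap.ker (rTensor Q f.toLinearMap)).subtype (LinearMap.id : D →ₗ[R] D)) := by
  have hexact := Module.Flat.rTensor_exact D
    (LinearMap.exact_subtype_ker_map (rTensor Q f.toLinearMap))
  refine (hexact _).mp ?_
  rw [rTensor_baseChangeCoaction _ (Coalgebra.comul : D →ₗ[R] D ⊗[R] D), LinearMap.mem_ker.mp hx,
    map_zero]
  rw [← LinearMap.comp_assoc, rTensor_comp_lTensor]
  exact f.map_comp_comul

/-- A `C`-stable submodule of `C ⊗ Q` killed by the base change to `Q` of a coalgebra map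
`f : C → D` is zero. -/
theorem eq_bot_of_le_ker_of_baseChangeCoaction_stable [Coalgebra R C] [Coalgebra R D]
    (f : C →ₗc[R] D) {N : Submodule R (C ⊗[R] Q)}
    (hN : N ≤ LinearMap.ker (rTensor Q f.toLinearMap))
    (hstable : ∀ x ∈ N, baseChangeCoaction R C C Q Coalgebra.comul x ∈
      LinearMap.range (TensorProduct.map N.subtype (LinearMap.id : C →ₗ[R] C))) :
    N = ⊥ := by
  have hcounit : rTensor Q (Coalgebra.counit : C →ₗ[R] R) ∘ₗ N.subtype = 0 := by
    ext y
    have hf : (Coalgebra.counit : C →ₗ[R] R) = Coalgebra.counit ∘ₗ f.toLinearMap :=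
      f.counit_comp.symm
    rw [hf, rTensor_comp, LinearMap.comp_apply, LinearMap.comp_apply, Submodule.subtype_apply,
      LinearMap.mem_ker.mp (hN y.2), map_zero, LinearMap.zero_apply]
  refine (Submodule.eq_bot_iff N).mpr fun x hx => ?_
  obtain ⟨y, hy⟩ := hstable x hx
  have hzero := rTensor_counit_baseChangeCoaction_comul x
  have hy' : rTensor C N.subtype y = baseChangeCoaction R C C Q Coalgebra.comul x := hy
  rw [← hy', ← LinearMap.comp_apply, ← rTensor_comp, hcounit, rTensor_zero,
    LinearMap.zero_apply] at hzero
  have hinj : Function.Injective (rTensor C (TensorProduct.lid R Q).symm.toLinearMap) :=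
    (LinearEquiv.rTensor C (TensorProduct.lid R Q).symm).injective
  refine (TensorProduct.comm R C Q).injective (hinj ?_)
  rw [← hzero, map_zero, map_zero]

end baseChangeCoaction

/-- **From non-purity to a non-liftable subcomodule.** Let `R` be a commutative
noetherian domain and `f : C → D` a homomorphism of flat `R`-coalgebras such that the
induced map `C ⊗ R/I → D ⊗ R/I` fails to be injective for some ideal `I` of `R`
(i.e. `f` is not pure as a map of `R`-modules).  Then the kernel `C₀` of
`C ⊗ R/I → D ⊗ R/I` is a nonzero submodule of the base-changed coalgebra `C ⊗ R/I`
which is stable under the (base-changed) coaction of `D ⊗ R/I` but not under the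
coaction of `C ⊗ R/I`; consequently there exist a `C`-comodule `M` and a
`D`-subcomodule `N ⊆ M` (via `f`) which is not `C`-stable. -/
theorem statement18 (R C D : Type) [CommRing R] [IsDomain R] [IsNoetherianRing R]
    [AddCommGroup C] [Module R C] [Coalgebra R C] [Module.Flat R C]
    [AddCommGroup D] [Module R D] [Coalgebra R D] [Module.Flat R D]
    (f : C →ₗc[R] D) (I : Ideal R)
    (hni : ¬ Function.Injective (rTensor (R ⧸ I) f.toLinearMap)) :
    LinearMap.ker (rTensor (R ⧸ I) f.toLinearMap) ≠ ⊥ ∧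
      (∀ x ∈ LinearMap.ker (rTensor (R ⧸ I) f.toLinearMap),
        baseChangeCoaction R C D (R ⧸ I)
            ((lTensor C f.toLinearMap) ∘ₗ (Coalgebra.comul : C →ₗ[R] C ⊗[R] C)) x ∈
          LinearMap.range (TensorProduct.map
            (LinearMap.ker (rTensor (R ⧸ I) f.toLinearMap)).subtype
            (LinearMap.id : D →ₗ[R] D))) ∧
      (¬ ∀ x ∈ LinearMap.ker (rTensor (R ⧸ I) f.toLinearMap),
        baseChangeCoaction R C C (R ⧸ I) (Coalgebra.comul : C →ₗ[R] C ⊗[R] C) x ∈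
          LinearMap.range (TensorProduct.map
            (LinearMap.ker (rTensor (R ⧸ I) f.toLinearMap)).subtype
            (LinearMap.id : C →ₗ[R] C))) ∧
      ∃ (M : Type) (_ : AddCommGroup M) (_ : Module R M) (ρ : M →ₗ[R] M ⊗[R] C),
        (∀ m : M, (TensorProduct.assoc R M C C) ((rTensor C ρ) (ρ m)) =
            (lTensor M (Coalgebra.comul : C →ₗ[R] C ⊗[R] C)) (ρ m)) ∧
        (∀ m : M, (TensorProduct.rid R M)
            ((lTensor M (Coalgebra.counit : C →ₗ[R] R)) (ρ m)) = m) ∧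
        ∃ N : Submodule R M,
          (∀ n ∈ N, (lTensor M f.toLinearMap) (ρ n) ∈
              LinearMap.range (TensorProduct.map N.subtype (LinearMap.id : D →ₗ[R] D))) ∧
          ¬ ∀ n ∈ N, ρ n ∈
              LinearMap.range (TensorProduct.map N.subtype (LinearMap.id : C →ₗ[R] C)) := by
  have hker : LinearMap.ker (rTensor (R ⧸ I) f.toLinearMap) ≠ ⊥ := fun h =>
    hni (LinearMap.ker_eq_bot.mp h)
  have hnot := fun h => hker (eq_bot_of_le_ker_of_baseChangeCoaction_stable f le_rfl h)
  refine ⟨hker, fun x hx => baseChangeCoaction_mem_range_of_mem_ker f hx, hnot,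
    C ⊗[R] (R ⧸ I), inferInstance, inferInstance,
    baseChangeCoaction R C C (R ⧸ I) Coalgebra.comul, baseChangeCoaction_comul_coassoc,
    baseChangeCoaction_comul_counit, LinearMap.ker (rTensor (R ⧸ I) f.toLinearMap),
    fun x hx => ?_, hnot⟩
  rw [lTensor_baseChangeCoaction]
  exact baseChangeCoaction_mem_range_of_mem_ker f hx
end
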